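/- arXiv:1608.00564 — 6 statements merged into one kernel-verified Lean document; each statement's English description precedes it below -/
import Mathlib

section
/- The polynomial f(z₀,z₁,z₂,z₃,z₄) = z₀¹¹ + z₀z₁⁷⁵ + z₁z₂⁵ + z₂z₃² + z₃z₄² in ℂ[z₀,...,z₄] is weighted homogeneous of degree 825 with weights (75, 10, 163, 331, 247), i.e. f(λ⁷⁵z₀, λ¹⁰z₁, λ¹⁶³z₂, λ³³¹z₃, λ²⁴⁷z₄) = λ⁸²⁵ f(z₀,z₁,z₂,z₃,z₄) for all λ ∈ ℂ, and it has an isolated singularity at the origin: if all five partial derivatives of f vanish at a point z ∈ ℂ⁵, then z = 0. -/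
/-- The derivative of `t ↦ a + b * t + c * t ^ n` at `x`. -/
theorem hasDerivAt_const_add_linear_add_pow (a b c x : ℂ) (n : ℕ) :
    HasDerivAt (fun t : ℂ => a + b * t + c * t ^ n) (b + c * (n * x ^ (n - 1))) x := by
  simpa using (((hasDerivAt_id x).const_mul b).const_add a).fun_add
    ((hasDerivAt_pow n x).const_mul c)

/-- The only common zero of the five partial derivatives is the origin. -/
theorem eq_zero_of_partials_eq_zero {a b c d e : ℂ}
    (h0 : b ^ 75 + 11 * a ^ 10 = 0) (h1 : c ^ 5 + a * (75 * b ^ 74) = 0)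
    (h2 : d ^ 2 + b * (5 * c ^ 4) = 0) (h3 : e ^ 2 + c * (2 * d) = 0)
    (h4 : d * (2 * e) = 0) : a = 0 ∧ b = 0 ∧ c = 0 ∧ d = 0 ∧ e = 0 := by
  have he : e = 0 := by
    rcases mul_eq_zero.mp h4 with h | h
    · simpa [h] using h3
    · simpa using h
  have hd : d = 0 := by
    have h : c = 0 ∨ d = 0 := by simpa [he] using h3
    rcases h with h | h
    · simpa [h] using h2
    · exact h
  have hc : c = 0 := by
    have h : b = 0 ∨ c = 0 := by simpa [hd] using h2
    rcases h with h | h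
    · simpa [h] using h1
    · exact h
  have hab : a = 0 ∨ b = 0 := by simpa [hc] using h1
  rcases hab with h | h
  · exact ⟨h, by simpa [h] using h0, hc, hd, he⟩
  · exact ⟨by simpa [h] using h0, h, hc, hd, he⟩

/-- The polynomial `f(z) = z₀^11 + z₀z₁^75 + z₁z₂^5 + z₂z₃^2 + z₃z₄^2`
is weighted homogeneous of degree `825` with weights `(75, 10, 163, 331, 247)`, and has an
isolated singularity at the origin: if all five partial derivatives `∂f/∂zᵢ`
vanish at a point `z ∈ ℂ⁵`, then `z = 0`. -/
theorem orlik_poly_stmt10 :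
    let w : Fin 5 → ℕ := ![75, 10, 163, 331, 247]
    let f : (Fin 5 → ℂ) → ℂ := fun z =>
      z 0 ^ 11 + z 0 * z 1 ^ 75 + z 1 * z 2 ^ 5 + z 2 * z 3 ^ 2 + z 3 * z 4 ^ 2
    (∀ (lam : ℂ) (z : Fin 5 → ℂ),
        f (fun i => lam ^ w i * z i) = lam ^ 825 * f z) ∧
    (∀ z : Fin 5 → ℂ,
        (∀ i : Fin 5, deriv (fun t => f (Function.update z i t)) (z i) = 0) →
        z = 0) := by
  intro w f
  refine ⟨fun lam z => ?_, fun z hz => ?_⟩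
  · simp only [f, w, Matrix.cons_val]
    ring
  · have key : ∀ (i : Fin 5) (a b c : ℂ) (n : ℕ),
        (∀ t, f (Function.update z i t) = a + b * t + c * t ^ n) →
        b + c * (n * z i ^ (n - 1)) = 0 := fun i a b c n h => by
      rw [← (hasDerivAt_const_add_linear_add_pow a b c (z i) n).deriv, ← hz i]
      exact congrArg (deriv · (z i)) (funext fun t => (h t).symm)
    have h0 := key 0 (z 1 * z 2 ^ 5 + z 2 * z 3 ^ 2 + z 3 * z 4 ^ 2) (z 1 ^ 75) 1 11
      fun t => by simp [f]; ring
    have h1 := key 1 (z 0 ^ 11 + z 2 * z 3 ^ 2 + z 3 * z 4 ^ 2) (z 2 ^ 5) (z 0) 75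
      fun t => by simp [f]; ring
    have h2 := key 2 (z 0 ^ 11 + z 0 * z 1 ^ 75 + z 3 * z 4 ^ 2) (z 3 ^ 2) (z 1) 5
      fun t => by simp [f]; ring
    have h3 := key 3 (z 0 ^ 11 + z 0 * z 1 ^ 75 + z 1 * z 2 ^ 5) (z 4 ^ 2) (z 2) 2
      fun t => by simp [f]; ring
    have h4 := key 4 (z 0 ^ 11 + z 0 * z 1 ^ 75 + z 1 * z 2 ^ 5 + z 2 * z 3 ^ 2) 0 (z 3) 2
      fun t => by simp [f]
    obtain ⟨e0, e1, e2, e3, e4⟩ := eq_zero_of_partials_eq_zero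
      (by simpa only [Nat.cast_ofNat, one_mul] using h0) (by simpa only [Nat.cast_ofNat] using h1)
      (by simpa only [Nat.cast_ofNat] using h2) (by simpa using h3) (by simpa using h4)
    ext i
    fin_cases i <;> assumption
end

section
/- The polynomial f(z₀,z₁,z₂,z₃,z₄) = z₀⁷ + z₀z₁³ + z₁z₂² + z₂z₃³¹ + z₃z₄⁵ in ℂ[z₀,...,z₄] is weighted homogeneous of degree 434 with weights (62, 124, 155, 9, 85), i.e. f(λ⁶²z₀, λ¹²⁴z₁, λ¹⁵⁵z₂, λ⁹z₃, λ⁸⁵z₄) = λ⁴³⁴ f(z₀,z₁,z₂,z₃,z₄) for all λ ∈ ℂ, and it has an isolated singularity at the origin: if all five partial derivatives of f vanish at a point z ∈ ℂ⁵, then z = 0. -/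
theorem deriv_mul_pow_add_mul_add (a b c : ℂ) (n : ℕ) (x : ℂ) :
    deriv (fun t : ℂ => a * t ^ n + b * t + c) x = a * (n * x ^ (n - 1)) + b := by
  have h := ((((hasDerivAt_id x).fun_pow n).const_mul a).add
    ((hasDerivAt_id x).const_mul b)).add_const c
  have h' : HasDerivAt (fun t : ℂ => a * t ^ n + b * t + c) (a * (n * x ^ (n - 1)) + b) x := by
    simpa using h
  exact h'.deriv

theorem orlik_partials_eq_zero {x₀ x₁ x₂ x₃ x₄ : ℂ}
    (h₀ : 7 * x₀ ^ 6 + x₁ ^ 3 = 0) (h₁ : 3 * x₀ * x₁ ^ 2 + x₂ ^ 2 = 0)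
    (h₂ : 2 * x₁ * x₂ + x₃ ^ 31 = 0) (h₃ : 31 * x₂ * x₃ ^ 30 + x₄ ^ 5 = 0)
    (h₄ : 5 * x₃ * x₄ ^ 4 = 0) :
    x₀ = 0 ∧ x₁ = 0 ∧ x₂ = 0 ∧ x₃ = 0 ∧ x₄ = 0 := by
  have h₃' : x₃ = 0 := by
    by_contra hne
    have hx₄ : x₄ = 0 := by simpa [hne] using h₄
    have hx₂ : x₂ = 0 := by simpa [hx₄, hne] using h₃
    exact hne (by simpa [hx₂] using h₂)
  have h₄' : x₄ = 0 := by simpa [h₃'] using h₃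
  have h₁' : x₁ = 0 := by
    by_contra hne
    have hx₂ : x₂ = 0 := by simpa [h₃', hne] using h₂
    have hx₀ : x₀ = 0 := by simpa [hx₂, hne] using h₁
    exact hne (by simpa [hx₀] using h₀)
  have h₀' : x₀ = 0 := by simpa [h₁'] using h₀
  have h₂' : x₂ = 0 := by simpa [h₁'] using h₁
  exact ⟨h₀', h₁', h₂', h₃', h₄'⟩

/-- The polynomial `f(z) = z₀^7 + z₀z₁^3 + z₁z₂^2 + z₂z₃^31 + z₃z₄^5`
is weighted homogeneous of degree `434` with weights `(62, 124, 155, 9, 85)`, and has an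
isolated singularity at the origin: if all five partial derivatives `∂f/∂zᵢ`
vanish at a point `z ∈ ℂ⁵`, then `z = 0`. -/
theorem orlik_poly_stmt11 :
    let w : Fin 5 → ℕ := ![62, 124, 155, 9, 85]
    let f : (Fin 5 → ℂ) → ℂ := fun z =>
      z 0 ^ 7 + z 0 * z 1 ^ 3 + z 1 * z 2 ^ 2 + z 2 * z 3 ^ 31 + z 3 * z 4 ^ 5
    (∀ (lam : ℂ) (z : Fin 5 → ℂ),
        f (fun i => lam ^ w i * z i) = lam ^ 434 * f z) ∧
    (∀ z : Fin 5 → ℂ,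
        (∀ i : Fin 5, deriv (fun t => f (Function.update z i t)) (z i) = 0) →
        z = 0) := by
  intro w f
  refine ⟨fun lam z => ?_, fun z hz => ?_⟩
  · simp only [f, w, Matrix.cons_val]
    ring
  · have partial_eq (i : Fin 5) (a b c : ℂ) (n : ℕ)
        (h : ∀ t, f (Function.update z i t) = a * t ^ n + b * t + c) :
        a * (n * z i ^ (n - 1)) + b = 0 := by
      rw [← deriv_mul_pow_add_mul_add a b c n (z i), ← funext h]
      exact hz i
    have e₀ := partial_eq 0 1 (z 1 ^ 3) (z 1 * z 2 ^ 2 + z 2 * z 3 ^ 31 + z 3 * z 4 ^ 5) 7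
      (fun t => by simp [f]; ring)
    have e₁ := partial_eq 1 (z 0) (z 2 ^ 2) (z 0 ^ 7 + z 2 * z 3 ^ 31 + z 3 * z 4 ^ 5) 3
      (fun t => by simp [f]; ring)
    have e₂ := partial_eq 2 (z 1) (z 3 ^ 31) (z 0 ^ 7 + z 0 * z 1 ^ 3 + z 3 * z 4 ^ 5) 2
      (fun t => by simp [f]; ring)
    have e₃ := partial_eq 3 (z 2) (z 4 ^ 5) (z 0 ^ 7 + z 0 * z 1 ^ 3 + z 1 * z 2 ^ 2) 31
      (fun t => by simp [f]; ring)
    have e₄ := partial_eq 4 (z 3) 0 (z 0 ^ 7 + z 0 * z 1 ^ 3 + z 1 * z 2 ^ 2 + z 2 * z 3 ^ 31) 5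
      (fun t => by simp [f]; ring)
    norm_num at e₀ e₁ e₂ e₃
    push_cast at e₄
    obtain ⟨h₀, h₁, h₂, h₃, h₄⟩ := orlik_partials_eq_zero (x₀ := z 0) (x₁ := z 1) (x₂ := z 2)
      (x₃ := z 3) (x₄ := z 4) (by linear_combination e₀) (by linear_combination e₁)
      (by linear_combination e₂) (by linear_combination e₃) (by linear_combination e₄)
    ext i
    fin_cases i <;> assumption
end

section
/- The polynomial f(z₀,z₁,z₂,z₃,z₄) = z₀¹⁷⁵ + z₀z₁⁹ + z₁z₂³ + z₂z₃⁴ + z₃z₄² in ℂ[z₀,...,z₄] is weighted homogeneous of degree 1575 with weights (9, 174, 467, 277, 649), i.e. f(λ⁹z₀, λ¹⁷⁴z₁, λ⁴⁶⁷z₂, λ²⁷⁷z₃, λ⁶⁴⁹z₄) = λ¹⁵⁷⁵ f(z₀,z₁,z₂,z₃,z₄) for all λ ∈ ℂ, and it has an isolated singularity at the origin: if all five partial derivatives of f vanish at a point z ∈ ℂ⁵, then z = 0. -/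
theorem deriv_const_add_linear_add_monomial {𝕜 : Type*} [NontriviallyNormedField 𝕜]
    (k c b x : 𝕜) (n : ℕ) :
    deriv (fun t : 𝕜 => k + c * t + b * t ^ n) x = c + b * (n * x ^ (n - 1)) := by
  have h : HasDerivAt (fun t : 𝕜 => k + c * t + b * t ^ n) (c * 1 + b * (n * x ^ (n - 1))) x :=
    (((hasDerivAt_id x).const_mul c).const_add k).add ((hasDerivAt_pow n x).const_mul b)
  rw [h.deriv, mul_one]

theorem orlik_chain_eq_zero {R : Type*} [CommRing R] [IsDomain R] [CharZero R] {a b c d e : R}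
    (h0 : b ^ 9 + 175 * a ^ 174 = 0) (h1 : c ^ 3 + 9 * (a * b ^ 8) = 0)
    (h2 : d ^ 4 + 3 * (b * c ^ 2) = 0) (h3 : e ^ 2 + 4 * (c * d ^ 3) = 0) (h4 : d * e = 0) :
    a = 0 ∧ b = 0 ∧ c = 0 ∧ d = 0 ∧ e = 0 := by
  have hd : d = 0 := by
    rcases mul_eq_zero.mp h4 with hd | he
    · exact hd
    · have hcd : c = 0 ∨ d = 0 := by simpa [he] using h3
      rcases hcd with hc | hd
      · simpa [hc] using h2
      · exact hd
  have he : e = 0 := by simpa [hd] using h3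
  have hbc : b = 0 ∨ c = 0 := by simpa [hd] using h2
  have hb : b = 0 := by
    rcases hbc with hb | hc
    · exact hb
    · have hab : a = 0 ∨ b = 0 := by simpa [hc] using h1
      rcases hab with ha | hb
      · simpa [ha] using h0
      · exact hb
  have ha : a = 0 := by simpa [hb] using h0
  have hc : c = 0 := by simpa [hb] using h1
  exact ⟨ha, hb, hc, hd, he⟩

/-- The polynomial `f(z) = z₀^175 + z₀z₁^9 + z₁z₂^3 + z₂z₃^4 + z₃z₄^2`
is weighted homogeneous of degree `1575` with weights `(9, 174, 467, 277, 649)`, and has an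
isolated singularity at the origin: if all five partial derivatives `∂f/∂zᵢ`
vanish at a point `z ∈ ℂ⁵`, then `z = 0`. -/
theorem orlik_poly_stmt12 :
    let w : Fin 5 → ℕ := ![9, 174, 467, 277, 649]
    let f : (Fin 5 → ℂ) → ℂ := fun z =>
      z 0 ^ 175 + z 0 * z 1 ^ 9 + z 1 * z 2 ^ 3 + z 2 * z 3 ^ 4 + z 3 * z 4 ^ 2
    (∀ (lam : ℂ) (z : Fin 5 → ℂ),
        f (fun i => lam ^ w i * z i) = lam ^ 1575 * f z) ∧
    (∀ z : Fin 5 → ℂ,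
        (∀ i : Fin 5, deriv (fun t => f (Function.update z i t)) (z i) = 0) →
        z = 0) := by
  intro w f
  refine ⟨fun lam z => ?_, fun z hz => ?_⟩
  · simp only [w, f, Matrix.cons_val]
    ring
  · have h0 : z 1 ^ 9 + 175 * z 0 ^ 174 = 0 := by
      have h := hz 0
      rw [show (fun t => f (Function.update z 0 t)) =
          fun t => (z 1 * z 2 ^ 3 + z 2 * z 3 ^ 4 + z 3 * z 4 ^ 2) + z 1 ^ 9 * t + 1 * t ^ 175 by
        funext t; simp [f, Function.update]; ring,
        deriv_const_add_linear_add_monomial] at h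
      norm_num at h
      linear_combination h
    have h1 : z 2 ^ 3 + 9 * (z 0 * z 1 ^ 8) = 0 := by
      have h := hz 1
      rw [show (fun t => f (Function.update z 1 t)) =
          fun t => (z 0 ^ 175 + z 2 * z 3 ^ 4 + z 3 * z 4 ^ 2) + z 2 ^ 3 * t + z 0 * t ^ 9 by
        funext t; simp [f, Function.update]; ring,
        deriv_const_add_linear_add_monomial] at h
      norm_num at h
      linear_combination h
    have h2 : z 3 ^ 4 + 3 * (z 1 * z 2 ^ 2) = 0 := by
      have h := hz 2
      rw [show (fun t => f (Function.update z 2 t)) =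
          fun t => (z 0 ^ 175 + z 0 * z 1 ^ 9 + z 3 * z 4 ^ 2) + z 3 ^ 4 * t + z 1 * t ^ 3 by
        funext t; simp [f, Function.update]; ring,
        deriv_const_add_linear_add_monomial] at h
      norm_num at h
      linear_combination h
    have h3 : z 4 ^ 2 + 4 * (z 2 * z 3 ^ 3) = 0 := by
      have h := hz 3
      rw [show (fun t => f (Function.update z 3 t)) =
          fun t => (z 0 ^ 175 + z 0 * z 1 ^ 9 + z 1 * z 2 ^ 3) + z 4 ^ 2 * t + z 2 * t ^ 4 by
        funext t; simp [f, Function.update]; ring,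
        deriv_const_add_linear_add_monomial] at h
      norm_num at h
      linear_combination h
    have h4 : z 3 * z 4 = 0 := by
      have h := hz 4
      rw [show (fun t => f (Function.update z 4 t)) =
          fun t => (z 0 ^ 175 + z 0 * z 1 ^ 9 + z 1 * z 2 ^ 3 + z 2 * z 3 ^ 4) + 0 * t + z 3 * t ^ 2 by
        funext t; simp [f, Function.update],
        deriv_const_add_linear_add_monomial] at h
      simpa using h
    obtain ⟨ha, hb, hc, hd, he⟩ := orlik_chain_eq_zero h0 h1 h2 h3 h4
    funext i
    fin_cases i <;> assumption
end

section
/- The polynomial f(z₀,z₁,z₂,z₃,z₄) = z₀⁹ + z₀z₁² + z₁z₂³ + z₂z₃⁵⁸ + z₃z₄⁴ in ℂ[z₀,...,z₄] is weighted homogeneous of degree 783 with weights (87, 348, 145, 11, 193), i.e. f(λ⁸⁷z₀, λ³⁴⁸z₁, λ¹⁴⁵z₂, λ¹¹z₃, λ¹⁹³z₄) = λ⁷⁸³ f(z₀,z₁,z₂,z₃,z₄) for all λ ∈ ℂ, and it has an isolated singularity at the origin: if all five partial derivatives of f vanish at a point z ∈ ℂ⁵, then z = 0. -/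
/-- The derivative of `t ↦ A + B * t + C * t ^ n`. -/
theorem deriv_const_add_linear_add_pow (A B C x : ℂ) (n : ℕ) :
    deriv (fun t : ℂ => A + B * t + C * t ^ n) x = B + C * (n * x ^ (n - 1)) := by
  have h : HasDerivAt (fun t : ℂ => A + B * t + C * t ^ n)
      (B * 1 + C * (n * x ^ (n - 1))) x :=
    (((hasDerivAt_id' x).const_mul B).const_add A).add
      ((hasDerivAt_pow n x).const_mul C)
  simpa only [mul_one] using h.deriv

/-- The polynomial `f(z) = z₀^9 + z₀z₁^2 + z₁z₂^3 + z₂z₃^58 + z₃z₄^4`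
is weighted homogeneous of degree `783` with weights `(87, 348, 145, 11, 193)`, and has an
isolated singularity at the origin: if all five partial derivatives `∂f/∂zᵢ`
vanish at a point `z ∈ ℂ⁵`, then `z = 0`. -/
theorem orlik_poly_stmt13 :
    let w : Fin 5 → ℕ := ![87, 348, 145, 11, 193]
    let f : (Fin 5 → ℂ) → ℂ := fun z =>
      z 0 ^ 9 + z 0 * z 1 ^ 2 + z 1 * z 2 ^ 3 + z 2 * z 3 ^ 58 + z 3 * z 4 ^ 4
    (∀ (lam : ℂ) (z : Fin 5 → ℂ),
        f (fun i => lam ^ w i * z i) = lam ^ 783 * f z) ∧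
    (∀ z : Fin 5 → ℂ,
        (∀ i : Fin 5, deriv (fun t => f (Function.update z i t)) (z i) = 0) →
        z = 0) := by
  intro w f
  refine ⟨fun lam z => ?_, fun z h => ?_⟩
  · simp only [f, w, Matrix.cons_val]
    ring
  · have key : ∀ (i : Fin 5) (A B C : ℂ) (n : ℕ),
        (∀ t, f (Function.update z i t) = A + B * t + C * t ^ n) →
        B + C * (n * z i ^ (n - 1)) = 0 := by
      intro i A B C n hf
      rw [← deriv_const_add_linear_add_pow A B C (z i) n, ← funext hf]
      exact h i
    have h0 := key 0 (z 1 * z 2 ^ 3 + z 2 * z 3 ^ 58 + z 3 * z 4 ^ 4) (z 1 ^ 2) 1 9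
      (fun t => by simp [f]; ring)
    have h1 := key 1 (z 0 ^ 9 + z 2 * z 3 ^ 58 + z 3 * z 4 ^ 4) (z 2 ^ 3) (z 0) 2
      (fun t => by simp [f]; ring)
    have h2 := key 2 (z 0 ^ 9 + z 0 * z 1 ^ 2 + z 3 * z 4 ^ 4) (z 3 ^ 58) (z 1) 3
      (fun t => by simp [f]; ring)
    have h3 := key 3 (z 0 ^ 9 + z 0 * z 1 ^ 2 + z 1 * z 2 ^ 3) (z 4 ^ 4) (z 2) 58
      (fun t => by simp [f]; ring)
    have h4 := key 4 (z 0 ^ 9 + z 0 * z 1 ^ 2 + z 1 * z 2 ^ 3 + z 2 * z 3 ^ 58) 0 (z 3) 4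
      (fun t => by simp [f])
    have hd : z 3 = 0 := by
      by_contra hd
      have he : z 4 = 0 := by simpa [hd] using h4
      have hc : z 2 = 0 := by simpa [hd, he] using h3
      exact hd (by simpa [hc] using h2)
    have he : z 4 = 0 := by simpa [hd] using h3
    have hbc : z 1 = 0 ∨ z 2 = 0 := by simpa [hd] using h2
    have hab : z 0 = 0 ∧ z 1 = 0 := by
      rcases hbc with hb | hc
      · exact ⟨by simpa [hb] using h0, hb⟩
      · have hab : z 0 = 0 ∨ z 1 = 0 := by simpa [hc] using h1
        rcases hab with ha | hb
        · exact ⟨ha, by simpa [ha] using h0⟩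
        · exact ⟨by simpa [hb] using h0, hb⟩
    have hc : z 2 = 0 := by simpa [hab.1] using h1
    ext i
    fin_cases i
    exacts [hab.1, hab.2, hc, hd, he]
end

section
/- The polynomial f(z₀,z₁,z₂,z₃,z₄) = z₀⁸³ + z₀z₁⁵ + z₁z₂² + z₂z₃⁷ + z₃z₄³ in ℂ[z₀,...,z₄] is weighted homogeneous of degree 830 with weights (10, 164, 333, 71, 253), i.e. f(λ¹⁰z₀, λ¹⁶⁴z₁, λ³³³z₂, λ⁷¹z₃, λ²⁵³z₄) = λ⁸³⁰ f(z₀,z₁,z₂,z₃,z₄) for all λ ∈ ℂ, and it has an isolated singularity at the origin: if all five partial derivatives of f vanish at a point z ∈ ℂ⁵, then z = 0. -/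
theorem deriv_const_add_mul_add_mul_pow (a b c x : ℂ) (n : ℕ) :
    deriv (fun t => c + a * t + b * t ^ n) x = a + b * (n * x ^ (n - 1)) := by
  have h := (((hasDerivAt_id x).const_mul a).const_add c).add ((hasDerivAt_pow n x).const_mul b)
  rw [mul_one] at h
  exact h.deriv

/-- The Jacobian system of `x₀^83 + x₀x₁^5 + x₁x₂^2 + x₂x₃^7 + x₃x₄^3` has only the trivial
solution. -/
theorem orlik_jacobian_trivial {x₀ x₁ x₂ x₃ x₄ : ℂ}
    (h₀ : x₁ ^ 5 + 83 * x₀ ^ 82 = 0) (h₁ : x₂ ^ 2 + 5 * x₀ * x₁ ^ 4 = 0)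
    (h₂ : x₃ ^ 7 + 2 * x₁ * x₂ = 0) (h₃ : x₄ ^ 3 + 7 * x₂ * x₃ ^ 6 = 0)
    (h₄ : 3 * x₃ * x₄ ^ 2 = 0) :
    x₀ = 0 ∧ x₁ = 0 ∧ x₂ = 0 ∧ x₃ = 0 ∧ x₄ = 0 := by
  have hx₃ : x₃ = 0 := by
    by_contra hne
    have hx₄ : x₄ = 0 := by simpa [hne] using h₄
    have hx₂ : x₂ = 0 := by simpa [hx₄, hne] using h₃
    exact hne (by simpa [hx₂] using h₂)
  have hx₄ : x₄ = 0 := by simpa [hx₃] using h₃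
  have hx₁ : x₁ = 0 := by
    by_contra hne
    have hx₂ : x₂ = 0 := by simpa [hx₃, hne] using h₂
    have hx₀ : x₀ = 0 := by simpa [hx₂, hne] using h₁
    exact hne (by simpa [hx₀] using h₀)
  exact ⟨by simpa [hx₁] using h₀, hx₁, by simpa [hx₁] using h₁, hx₃, hx₄⟩

/-- The polynomial `f(z) = z₀^83 + z₀z₁^5 + z₁z₂^2 + z₂z₃^7 + z₃z₄^3`
is weighted homogeneous of degree `830` with weights `(10, 164, 333, 71, 253)`, and has an
isolated singularity at the origin: if all five partial derivatives `∂f/∂zᵢ`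
vanish at a point `z ∈ ℂ⁵`, then `z = 0`. -/
theorem orlik_poly_stmt16 :
    let w : Fin 5 → ℕ := ![10, 164, 333, 71, 253]
    let f : (Fin 5 → ℂ) → ℂ := fun z =>
      z 0 ^ 83 + z 0 * z 1 ^ 5 + z 1 * z 2 ^ 2 + z 2 * z 3 ^ 7 + z 3 * z 4 ^ 3
    (∀ (lam : ℂ) (z : Fin 5 → ℂ),
        f (fun i => lam ^ w i * z i) = lam ^ 830 * f z) ∧
    (∀ z : Fin 5 → ℂ,
        (∀ i : Fin 5, deriv (fun t => f (Function.update z i t)) (z i) = 0) →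
        z = 0) := by
  intro w f
  refine ⟨fun lam z => ?_, fun z hz => ?_⟩
  · simp only [w, f, Matrix.cons_val]
    ring
  have hderiv (i : Fin 5) (a b c : ℂ) (n : ℕ)
      (h : ∀ t, f (Function.update z i t) = c + a * t + b * t ^ n) :
      a + b * (n * z i ^ (n - 1)) = 0 := by
    rw [← deriv_const_add_mul_add_mul_pow a b c (z i) n, ← funext h]
    exact hz i
  have h₀ := hderiv 0 (z 1 ^ 5) 1
    (z 1 * z 2 ^ 2 + z 2 * z 3 ^ 7 + z 3 * z 4 ^ 3) 83
    (fun t => by simp [f]; ring)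
  have h₁ := hderiv 1 (z 2 ^ 2) (z 0)
    (z 0 ^ 83 + z 2 * z 3 ^ 7 + z 3 * z 4 ^ 3) 5
    (fun t => by simp [f]; ring)
  have h₂ := hderiv 2 (z 3 ^ 7) (z 1)
    (z 0 ^ 83 + z 0 * z 1 ^ 5 + z 3 * z 4 ^ 3) 2
    (fun t => by simp [f]; ring)
  have h₃ := hderiv 3 (z 4 ^ 3) (z 2)
    (z 0 ^ 83 + z 0 * z 1 ^ 5 + z 1 * z 2 ^ 2) 7
    (fun t => by simp [f]; ring)
  have h₄ := hderiv 4 0 (z 3)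
    (z 0 ^ 83 + z 0 * z 1 ^ 5 + z 1 * z 2 ^ 2 + z 2 * z 3 ^ 7) 3
    (fun t => by simp [f])
  norm_num at h₀ h₁ h₂ h₃ h₄
  obtain ⟨e₀, e₁, e₂, e₃, e₄⟩ := orlik_jacobian_trivial (x₀ := z 0) (x₁ := z 1) (x₂ := z 2)
    (x₃ := z 3) (x₄ := z 4) (by linear_combination h₀) (by linear_combination h₁)
    (by linear_combination h₂) (by linear_combination h₃) (by grind)
  ext i
  fin_cases i <;> assumption
end

section
/- The polynomial f(z₀,z₁,z₂,z₃,z₄) = z₀¹⁰ + z₀z₁² + z₁z₂¹⁶ + z₂z₃³ + z₃z₄⁷ in ℂ[z₀,...,z₄] is weighted homogeneous of degree 320 with weights (32, 144, 11, 103, 31), i.e. f(λ³²z₀, λ¹⁴⁴z₁, λ¹¹z₂, λ¹⁰³z₃, λ³¹z₄) = λ³²⁰ f(z₀,z₁,z₂,z₃,z₄) for all λ ∈ ℂ, and it has an isolated singularity at the origin: if all five partial derivatives of f vanish at a point z ∈ ℂ⁵, then z = 0. -/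
/-- The derivative of `t ↦ a + b t + c tⁿ`. -/
lemma deriv_const_add_linear_add_pow_s18 {g : ℂ → ℂ} (a b c : ℂ) (n : ℕ)
    (hg : ∀ t, g t = a + b * t + c * t ^ n) (x : ℂ) :
    deriv g x = b + c * (n * x ^ (n - 1)) := by
  obtain rfl : g = fun t => a + b * t + c * t ^ n := funext hg
  have h := (((hasDerivAt_id' x).const_mul b).const_add a).add ((hasDerivAt_pow n x).const_mul c)
  rw [mul_one] at h
  exact h.deriv

/-- The system of equations `∂f/∂zᵢ = 0` has only the trivial solution. -/
lemma eq_zero_of_orlik_gradient_eq_zero {x y z u v : ℂ}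
    (h0 : y ^ 2 + 10 * x ^ 9 = 0) (h1 : z ^ 16 + 2 * (x * y) = 0)
    (h2 : u ^ 3 + 16 * (y * z ^ 15) = 0) (h3 : v ^ 7 + 3 * (z * u ^ 2) = 0)
    (h4 : u * v ^ 6 = 0) : x = 0 ∧ y = 0 ∧ z = 0 ∧ u = 0 ∧ v = 0 := by
  have hu : u = 0 := by
    by_contra hu
    have hv : v = 0 := by simpa [hu] using h4
    have hz : z = 0 := by simpa [hu, hv] using h3
    exact hu (by simpa [hz] using h2)
  have hv : v = 0 := by simpa [hu] using h3
  have hyz : y = 0 ∨ z = 0 := by simpa [hu] using h2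
  have hy : y = 0 := by
    rcases hyz with hy | hz
    · exact hy
    · have hxy : x = 0 ∨ y = 0 := by simpa [hz] using h1
      rcases hxy with hx | hy
      · simpa [hx] using h0
      · exact hy
  have hx : x = 0 := by simpa [hy] using h0
  have hz : z = 0 := by simpa [hy] using h1
  exact ⟨hx, hy, hz, hu, hv⟩

/-- The polynomial `f(z) = z₀^10 + z₀z₁^2 + z₁z₂^16 + z₂z₃^3 + z₃z₄^7`
is weighted homogeneous of degree `320` with weights `(32, 144, 11, 103, 31)`, and has an
isolated singularity at the origin: if all five partial derivatives `∂f/∂zᵢ`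
vanish at a point `z ∈ ℂ⁵`, then `z = 0`. -/
theorem orlik_poly_stmt18 :
    let w : Fin 5 → ℕ := ![32, 144, 11, 103, 31]
    let f : (Fin 5 → ℂ) → ℂ := fun z =>
      z 0 ^ 10 + z 0 * z 1 ^ 2 + z 1 * z 2 ^ 16 + z 2 * z 3 ^ 3 + z 3 * z 4 ^ 7
    (∀ (lam : ℂ) (z : Fin 5 → ℂ),
        f (fun i => lam ^ w i * z i) = lam ^ 320 * f z) ∧
    (∀ z : Fin 5 → ℂ,
        (∀ i : Fin 5, deriv (fun t => f (Function.update z i t)) (z i) = 0) →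
        z = 0) := by
  intro w f
  refine ⟨fun lam z => ?_, fun z h => ?_⟩
  · simp [f, w]
    ring
  have h0 := h 0
  rw [deriv_const_add_linear_add_pow_s18 (z 1 * z 2 ^ 16 + z 2 * z 3 ^ 3 + z 3 * z 4 ^ 7) (z 1 ^ 2) (1) 10
    (fun t => by simp [f, Function.update]; try ring)] at h0
  have h1 := h 1
  rw [deriv_const_add_linear_add_pow_s18 (z 0 ^ 10 + z 2 * z 3 ^ 3 + z 3 * z 4 ^ 7) (z 2 ^ 16) (z 0) 2
    (fun t => by simp [f, Function.update]; try ring)] at h1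
  have h2 := h 2
  rw [deriv_const_add_linear_add_pow_s18 (z 0 ^ 10 + z 0 * z 1 ^ 2 + z 3 * z 4 ^ 7) (z 3 ^ 3) (z 1) 16
    (fun t => by simp [f, Function.update]; try ring)] at h2
  have h3 := h 3
  rw [deriv_const_add_linear_add_pow_s18 (z 0 ^ 10 + z 0 * z 1 ^ 2 + z 1 * z 2 ^ 16) (z 4 ^ 7) (z 2) 3
    (fun t => by simp [f, Function.update]; try ring)] at h3
  have h4 := h 4
  rw [deriv_const_add_linear_add_pow_s18 (z 0 ^ 10 + z 0 * z 1 ^ 2 + z 1 * z 2 ^ 16 + z 2 * z 3 ^ 3) (0) (z 3) 7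
    (fun t => by simp [f, Function.update]; try ring)] at h4
  norm_num at h0 h1 h2 h3
  obtain ⟨e0, e1, e2, e3, e4⟩ := eq_zero_of_orlik_gradient_eq_zero
    (x := z 0) (y := z 1) (z := z 2) (u := z 3) (v := z 4)
    (by linear_combination h0) (by linear_combination h1) (by linear_combination h2)
    (by linear_combination h3) (by push_cast at h4; linear_combination h4 / 7)
  funext i
  fin_cases i <;> assumption
end
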